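/- Let H be a weak Hopf algebra over k. Then the comultiplication, regarded as a coaction ρ = Δ of H on itself, makes H a right H-comodule algebra; its coinvariant subalgebra equals H^L = Im Π^L, and the Galois map β : H⊗_{H^L}H → (H⊗H)Δ(1) induced by x⊗y ↦ x y₍₁₎ ⊗ y₍₂₎ is bijective. Thus H is a weak H-Galois extension of H^L. -/

import Mathlib

noncomputable section

open TensorProduct LinearMap

/-- A weak bialgebra over a field `k`: a finite-dimensional `k`-algebra with a `k`-coalgebra
structure whose comultiplication is multiplicative, with the weakened unit and counit axioms. -/
structure WeakBialgebra (k : Type*) [Field k] (H : Type*) [Ring H] [Algebra k H]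
    [FiniteDimensional k H] where
  comul : H →ₗ[k] H ⊗[k] H
  counit : H →ₗ[k] k
  coassoc : ∀ x : H,
    (TensorProduct.assoc k H H H) ((rTensor H comul) (comul x)) = (lTensor H comul) (comul x)
  rTensor_counit_comul : ∀ x : H, (TensorProduct.lid k H) ((rTensor H counit) (comul x)) = x
  lTensor_counit_comul : ∀ x : H, (TensorProduct.rid k H) ((lTensor H counit) (comul x)) = x
  comul_mul : ∀ a b : H, comul (a * b) = comul a * comul b
  -- `1₍₁₎ ⊗ 1₍₂₎ ⊗ 1₍₃₎ = (Δ(1) ⊗ 1)(1 ⊗ Δ(1)) = (1 ⊗ Δ(1))(Δ(1) ⊗ 1)`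
  weak_one₁ : (lTensor H comul) (comul 1)
    = (TensorProduct.assoc k H H H) ((comul 1) ⊗ₜ[k] (1 : H)) * ((1 : H) ⊗ₜ[k] (comul 1))
  weak_one₂ : (lTensor H comul) (comul 1)
    = ((1 : H) ⊗ₜ[k] (comul 1)) * (TensorProduct.assoc k H H H) ((comul 1) ⊗ₜ[k] (1 : H))
  -- `ε(abc) = ε(ab₍₁₎)ε(b₍₂₎c) = ε(ab₍₂₎)ε(b₍₁₎c)`
  weak_counit₁ : ∀ a b c : H, counit (a * b * c)
    = (LinearMap.mul' k k)
        ((TensorProduct.map (counit ∘ₗ mulLeft k a) (counit ∘ₗ mulRight k c)) (comul b))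
  weak_counit₂ : ∀ a b c : H, counit (a * b * c)
    = (LinearMap.mul' k k)
        ((TensorProduct.map (counit ∘ₗ mulRight k c) (counit ∘ₗ mulLeft k a)) (comul b))

namespace WeakBialgebra

variable {k : Type*} [Field k] {H : Type*} [Ring H] [Algebra k H] [FiniteDimensional k H]
variable (wb : WeakBialgebra k H)

/-- `ε ⊗ id : H ⊗ H → H`. -/
def εid : H ⊗[k] H →ₗ[k] H := (TensorProduct.lid k H).toLinearMap ∘ₗ rTensor H wb.counit

/-- `id ⊗ ε : H ⊗ H → H`. -/
def idε : H ⊗[k] H →ₗ[k] H := (TensorProduct.rid k H).toLinearMap ∘ₗ lTensor H wb.counit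

/-- `Π^L(x) = ε(1₍₁₎x) 1₍₂₎`. -/
def projL : H →ₗ[k] H :=
  wb.εid ∘ₗ mulLeft k (wb.comul 1) ∘ₗ (TensorProduct.mk k H H).flip 1

/-- `Π^R(x) = 1₍₁₎ ε(x1₍₂₎)`. -/
def projR : H →ₗ[k] H :=
  wb.idε ∘ₗ mulRight k (wb.comul 1) ∘ₗ TensorProduct.mk k H H 1

/-- `Π̄^L(x) = 1₍₁₎ ε(1₍₂₎x)`. -/
def projBarL : H →ₗ[k] H :=
  wb.idε ∘ₗ mulLeft k (wb.comul 1) ∘ₗ TensorProduct.mk k H H 1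

/-- `Π̄^R(x) = ε(x1₍₁₎) 1₍₂₎`. -/
def projBarR : H →ₗ[k] H :=
  wb.εid ∘ₗ mulRight k (wb.comul 1) ∘ₗ (TensorProduct.mk k H H).flip 1

/-- The antipode axioms for a weak Hopf algebra: `S(x₍₁₎)x₍₂₎ = Π^R(x)`,
`x₍₁₎S(x₍₂₎) = Π^L(x)` and `S(x₍₁₎)x₍₂₎S(x₍₃₎) = S(x)`. -/
structure IsAntipode (S : H →ₗ[k] H) : Prop where
  antipode_left : ∀ x : H, LinearMap.mul' k H ((rTensor H S) (wb.comul x)) = wb.projR x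
  antipode_right : ∀ x : H, LinearMap.mul' k H ((lTensor H S) (wb.comul x)) = wb.projL x
  antipode_mid : ∀ x : H,
    LinearMap.mul' k H
      ((TensorProduct.map (LinearMap.mul' k H ∘ₗ rTensor H S) S)
        ((rTensor H wb.comul) (wb.comul x))) = S x

end WeakBialgebra

/-- A right `H`-comodule algebra over a weak bialgebra `H`. -/
structure ComodAlg {k : Type*} [Field k] {H : Type*} [Ring H] [Algebra k H]
    [FiniteDimensional k H] (wb : WeakBialgebra k H)
    (A : Type*) [Ring A] [Algebra k A] where
  ρ : A →ₗ[k] A ⊗[k] H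
  coassoc : ∀ a : A,
    (TensorProduct.assoc k A H H) ((rTensor H ρ) (ρ a)) = (lTensor A wb.comul) (ρ a)
  counital : ∀ a : A, (TensorProduct.rid k A) ((lTensor A wb.counit) (ρ a)) = a
  mul : ∀ a b : A, ρ (a * b) = ρ a * ρ b
  piL : ∀ a : A, (lTensor A wb.projL) (ρ a) = ρ 1 * (a ⊗ₜ[k] (1 : H))
  pibarR : ∀ a : A, (lTensor A wb.projBarR) (ρ a) = (a ⊗ₜ[k] (1 : H)) * ρ 1

namespace ComodAlg

variable {k : Type*} [Field k] {H : Type*} [Ring H] [Algebra k H] [FiniteDimensional k H]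
variable {wb : WeakBialgebra k H} {A : Type*} [Ring A] [Algebra k A]

/-- The coinvariant subalgebra `B = {b ∈ A : ρ(b) = 1₍₀₎b ⊗ 1₍₁₎}`. -/
def coinv (ca : ComodAlg wb A) : Set A := {b | ca.ρ b = ca.ρ 1 * (b ⊗ₜ[k] (1 : H))}

/-- The `B`-balancing relations in `A ⊗_k A`, realizing `A ⊗_B A`. -/
def rel (ca : ComodAlg wb A) : Submodule k (A ⊗[k] A) :=
  Submodule.span k
    {z | ∃ a a' b : A, b ∈ ca.coinv ∧ z = (a * b) ⊗ₜ[k] a' - a ⊗ₜ[k] (b * a')}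

/-- `A ⊗_B A`. -/
abbrev QA (ca : ComodAlg wb A) := (A ⊗[k] A) ⧸ ca.rel

/-- The canonical quotient map `A ⊗_k A → A ⊗_B A`. -/
def mkA (ca : ComodAlg wb A) : A ⊗[k] A →ₗ[k] ca.QA := ca.rel.mkQ

end ComodAlg

section Helpers

variable {k : Type*} [Field k] {H : Type*} [Ring H] [Algebra k H]

theorem tensorAssoc_mul (s t : (H ⊗[k] H) ⊗[k] H) :
    TensorProduct.assoc k H H H (s * t)
      = TensorProduct.assoc k H H H s * TensorProduct.assoc k H H H t :=
  map_mul (Algebra.TensorProduct.assoc k k k H H H) s t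

/-- The map `a ⊗ b ↦ (a ⊗ 1) f(b)`. -/
def leftMulExtend (f : H →ₗ[k] H ⊗[k] H) : H ⊗[k] H →ₗ[k] H ⊗[k] H :=
  TensorProduct.lift
    ((LinearMap.mul k (H ⊗[k] H)).compl₁₂ ((TensorProduct.mk k H H).flip 1) f)

@[simp]
theorem leftMulExtend_tmul (f : H →ₗ[k] H ⊗[k] H) (a b : H) :
    leftMulExtend f (a ⊗ₜ[k] b) = (a ⊗ₜ[k] (1 : H)) * f b := rfl

theorem leftMulExtend_mul (f : H →ₗ[k] H ⊗[k] H) (a : H) (t : H ⊗[k] H) :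
    leftMulExtend f ((a ⊗ₜ[k] (1 : H)) * t) = (a ⊗ₜ[k] (1 : H)) * leftMulExtend f t := by
  induction t with
  | zero => simp
  | add s t hs ht => rw [mul_add, map_add, hs, ht, map_add, mul_add]
  | tmul b c =>
    simp only [Algebra.TensorProduct.tmul_mul_tmul, one_mul, leftMulExtend_tmul, ← mul_assoc]

theorem rTensor_mul'_map_assoc_symm (f g : H →ₗ[k] H) (a : H) (u : H ⊗[k] H) :
    rTensor H (LinearMap.mul' k H ∘ₗ TensorProduct.map f g)
        ((TensorProduct.assoc k H H H).symm (a ⊗ₜ[k] u))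
      = (f a ⊗ₜ[k] (1 : H)) * rTensor H g u := by
  induction u with
  | zero => simp
  | add s t hs ht => simp only [map_add, hs, ht, TensorProduct.tmul_add, mul_add]
  | tmul b c => simp

namespace WeakBialgebra

variable [FiniteDimensional k H] (wb : WeakBialgebra k H)

@[simp]
theorem εid_tmul (a b : H) : wb.εid (a ⊗ₜ[k] b) = wb.counit a • b := rfl

@[simp]
theorem idε_tmul (a b : H) : wb.idε (a ⊗ₜ[k] b) = wb.counit b • a := rfl

theorem projL_apply (x : H) : wb.projL x = wb.εid (wb.comul 1 * (x ⊗ₜ[k] 1)) := rfl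

theorem projR_apply (x : H) : wb.projR x = wb.idε ((1 ⊗ₜ[k] x) * wb.comul 1) := rfl

theorem projBarR_apply (x : H) : wb.projBarR x = wb.εid ((x ⊗ₜ[k] 1) * wb.comul 1) := rfl

theorem εid_comul (x : H) : wb.εid (wb.comul x) = x := wb.rTensor_counit_comul x

theorem idε_comul (x : H) : wb.idε (wb.comul x) = x := wb.lTensor_counit_comul x

theorem comul_one_mul_comul (x : H) : wb.comul 1 * wb.comul x = wb.comul x := by
  rw [← wb.comul_mul, one_mul]

theorem comul_mul_comul_one (x : H) : wb.comul x * wb.comul 1 = wb.comul x := by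
  rw [← wb.comul_mul, mul_one]

theorem rTensor_comul_mul (s t : H ⊗[k] H) :
    rTensor H wb.comul (s * t) = rTensor H wb.comul s * rTensor H wb.comul t := by
  induction s with
  | zero => simp
  | add s₁ s₂ h₁ h₂ => rw [add_mul, map_add, h₁, h₂, map_add, add_mul]
  | tmul a b =>
    induction t with
    | zero => simp
    | add t₁ t₂ h₁ h₂ => rw [mul_add, map_add, h₁, h₂, map_add, mul_add]
    | tmul c d => simp [wb.comul_mul]

theorem lTensor_comul_mul (s t : H ⊗[k] H) :
    lTensor H wb.comul (s * t) = lTensor H wb.comul s * lTensor H wb.comul t := by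
  induction s with
  | zero => simp
  | add s₁ s₂ h₁ h₂ => rw [add_mul, map_add, h₁, h₂, map_add, add_mul]
  | tmul a b =>
    induction t with
    | zero => simp
    | add t₁ t₂ h₁ h₂ => rw [mul_add, map_add, h₁, h₂, map_add, mul_add]
    | tmul c d => simp [wb.comul_mul]

theorem lTensor_εid_lTensor_comul (t : H ⊗[k] H) :
    lTensor H wb.εid (lTensor H wb.comul t) = t := by
  induction t with
  | zero => simp
  | add s t hs ht => simp only [map_add, hs, ht]
  | tmul a b => simp [wb.εid_comul]

theorem lTensor_εid_assoc (u : H ⊗[k] H) (b : H) :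
    lTensor H wb.εid (TensorProduct.assoc k H H H (u ⊗ₜ[k] b)) = wb.idε u ⊗ₜ[k] b := by
  induction u with
  | zero => simp
  | add s t hs ht => simp only [map_add, hs, ht, TensorProduct.add_tmul]
  | tmul a c => simp [TensorProduct.smul_tmul]

theorem lTensor_εid_assoc_rTensor_comul (t : H ⊗[k] H) :
    lTensor H wb.εid (TensorProduct.assoc k H H H (rTensor H wb.comul t)) = t := by
  induction t with
  | zero => simp
  | add s t hs ht => simp only [map_add, hs, ht]
  | tmul a b => rw [rTensor_tmul, lTensor_εid_assoc, idε_comul]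

theorem lTensor_projL (t : H ⊗[k] H) :
    lTensor H wb.projL t = lTensor H wb.εid
      (((1 : H) ⊗ₜ[k] wb.comul 1) * TensorProduct.assoc k H H H (t ⊗ₜ[k] (1 : H))) := by
  induction t with
  | zero => simp
  | add s t hs ht => simp only [map_add, hs, ht, TensorProduct.add_tmul, mul_add]
  | tmul a b => simp [projL_apply]

theorem lTensor_projBarR (t : H ⊗[k] H) :
    lTensor H wb.projBarR t = lTensor H wb.εid
      (TensorProduct.assoc k H H H (t ⊗ₜ[k] (1 : H)) * ((1 : H) ⊗ₜ[k] wb.comul 1)) := by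
  induction t with
  | zero => simp
  | add s t hs ht => simp only [map_add, hs, ht, TensorProduct.add_tmul, add_mul]
  | tmul a b => simp [projBarR_apply]

theorem rTensor_projR (t : H ⊗[k] H) :
    rTensor H wb.projR t = lTensor H wb.εid
      (((1 : H) ⊗ₜ[k] t) * TensorProduct.assoc k H H H (wb.comul 1 ⊗ₜ[k] (1 : H))) := by
  induction t with
  | zero => simp
  | add s t hs ht => simp only [map_add, hs, ht, TensorProduct.tmul_add, add_mul]
  | tmul a b =>
    have h : ((1 : H) ⊗ₜ[k] (a ⊗ₜ[k] b))
        = TensorProduct.assoc k H H H (((1 : H) ⊗ₜ[k] a) ⊗ₜ[k] b) := rfl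
    rw [h, ← tensorAssoc_mul, Algebra.TensorProduct.tmul_mul_tmul, mul_one, lTensor_εid_assoc,
      rTensor_tmul, projR_apply]

theorem lTensor_projL_comul (x : H) :
    lTensor H wb.projL (wb.comul x) = wb.comul 1 * (x ⊗ₜ[k] (1 : H)) := by
  have h : ((1 : H) ⊗ₜ[k] wb.comul 1)
        * TensorProduct.assoc k H H H (wb.comul x ⊗ₜ[k] (1 : H))
      = TensorProduct.assoc k H H H (rTensor H wb.comul (wb.comul 1 * (x ⊗ₜ[k] (1 : H)))) := by
    rw [rTensor_comul_mul, tensorAssoc_mul, wb.coassoc, wb.weak_one₂, rTensor_tmul, mul_assoc,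
      ← tensorAssoc_mul, Algebra.TensorProduct.tmul_mul_tmul, comul_one_mul_comul, one_mul]
  rw [lTensor_projL, h, lTensor_εid_assoc_rTensor_comul]

theorem lTensor_projBarR_comul (x : H) :
    lTensor H wb.projBarR (wb.comul x) = (x ⊗ₜ[k] (1 : H)) * wb.comul 1 := by
  have h : TensorProduct.assoc k H H H (wb.comul x ⊗ₜ[k] (1 : H))
        * ((1 : H) ⊗ₜ[k] wb.comul 1)
      = TensorProduct.assoc k H H H (rTensor H wb.comul ((x ⊗ₜ[k] (1 : H)) * wb.comul 1)) := by
    rw [rTensor_comul_mul, tensorAssoc_mul, wb.coassoc, wb.weak_one₁, rTensor_tmul, ← mul_assoc,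
      ← tensorAssoc_mul, Algebra.TensorProduct.tmul_mul_tmul, comul_mul_comul_one, one_mul]
  rw [lTensor_projBarR, h, lTensor_εid_assoc_rTensor_comul]

theorem rTensor_projR_comul (y : H) :
    rTensor H wb.projR (wb.comul y) = ((1 : H) ⊗ₜ[k] y) * wb.comul 1 := by
  have h : ((1 : H) ⊗ₜ[k] wb.comul y)
        * TensorProduct.assoc k H H H (wb.comul 1 ⊗ₜ[k] (1 : H))
      = lTensor H wb.comul (((1 : H) ⊗ₜ[k] y) * wb.comul 1) := by
    rw [lTensor_comul_mul, wb.weak_one₂, lTensor_tmul, ← mul_assoc,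
      Algebra.TensorProduct.tmul_mul_tmul, comul_mul_comul_one, one_mul]
  rw [rTensor_projR, h, lTensor_εid_lTensor_comul]

/-- The map `a ⊗ u ↦ ε(ax) u`. -/
def counitMulRight (x : H) (M : Type*) [AddCommGroup M] [Module k M] : H ⊗[k] M →ₗ[k] M :=
  (TensorProduct.lid k M).toLinearMap ∘ₗ rTensor M (wb.counit ∘ₗ mulRight k x)

@[simp]
theorem counitMulRight_tmul (x : H) {M : Type*} [AddCommGroup M] [Module k M] (a : H) (u : M) :
    wb.counitMulRight x M (a ⊗ₜ[k] u) = wb.counit (a * x) • u := rfl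

theorem εid_mul_tmul_one (x : H) (t : H ⊗[k] H) :
    wb.εid (t * (x ⊗ₜ[k] 1)) = wb.counitMulRight x H t := by
  induction t with
  | zero => simp
  | add s t hs ht => simp only [map_add, hs, ht, add_mul]
  | tmul a b => simp

theorem comul_counitMulRight (x : H) (t : H ⊗[k] H) :
    wb.comul (wb.counitMulRight x H t)
      = wb.counitMulRight x (H ⊗[k] H) (lTensor H wb.comul t) := by
  induction t with
  | zero => simp
  | add s t hs ht => simp only [map_add, hs, ht]
  | tmul a b => simp

theorem counitMulRight_one_tmul_mul_assoc (x : H) (t u : H ⊗[k] H) :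
    wb.counitMulRight x (H ⊗[k] H)
        (((1 : H) ⊗ₜ[k] u) * TensorProduct.assoc k H H H (t ⊗ₜ[k] (1 : H)))
      = u * (wb.counitMulRight x H t ⊗ₜ[k] (1 : H)) := by
  induction t with
  | zero => simp
  | add s t hs ht => simp only [map_add, hs, ht, TensorProduct.add_tmul, mul_add]
  | tmul a b => simp [← TensorProduct.smul_tmul']

theorem counitMulRight_assoc_mul_one_tmul (x : H) (t u : H ⊗[k] H) :
    wb.counitMulRight x (H ⊗[k] H)
        (TensorProduct.assoc k H H H (t ⊗ₜ[k] (1 : H)) * ((1 : H) ⊗ₜ[k] u))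
      = (wb.counitMulRight x H t ⊗ₜ[k] (1 : H)) * u := by
  induction t with
  | zero => simp
  | add s t hs ht => simp only [map_add, hs, ht, TensorProduct.add_tmul, add_mul]
  | tmul a b => simp [← TensorProduct.smul_tmul']

theorem comul_projL (x : H) :
    wb.comul (wb.projL x) = wb.comul 1 * (wb.projL x ⊗ₜ[k] (1 : H)) := by
  rw [projL_apply, εid_mul_tmul_one, comul_counitMulRight, wb.weak_one₂,
    counitMulRight_one_tmul_mul_assoc]

theorem comul_projL' (x : H) :
    wb.comul (wb.projL x) = (wb.projL x ⊗ₜ[k] (1 : H)) * wb.comul 1 := by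
  rw [projL_apply, εid_mul_tmul_one, comul_counitMulRight, wb.weak_one₁,
    counitMulRight_assoc_mul_one_tmul]

theorem comul_projL_mul (x y : H) :
    wb.comul (wb.projL x * y) = (wb.projL x ⊗ₜ[k] (1 : H)) * wb.comul y := by
  rw [wb.comul_mul, comul_projL', mul_assoc, comul_one_mul_comul]

theorem εid_mul_one_tmul (t : H ⊗[k] H) (b : H) :
    wb.εid (t * ((1 : H) ⊗ₜ[k] b)) = wb.εid t * b := by
  induction t with
  | zero => simp
  | add s t hs ht => simp only [map_add, hs, ht, add_mul]
  | tmul a c => simp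

theorem mul'_rTensor_projL (t : H ⊗[k] H) :
    LinearMap.mul' k H (rTensor H wb.projL t) = wb.εid (wb.comul 1 * t) := by
  induction t with
  | zero => simp
  | add s t hs ht => simp only [map_add, hs, ht, mul_add]
  | tmul a b =>
    rw [rTensor_tmul, mul'_apply, projL_apply, ← εid_mul_one_tmul, mul_assoc,
      Algebra.TensorProduct.tmul_mul_tmul, mul_one, one_mul]

theorem mul'_rTensor_projL_comul (y : H) :
    LinearMap.mul' k H (rTensor H wb.projL (wb.comul y)) = y := by
  rw [mul'_rTensor_projL, comul_one_mul_comul, εid_comul]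

theorem rTensor_mul'_comul (f g φ : H →ₗ[k] H)
    (h : ∀ x, LinearMap.mul' k H (TensorProduct.map f g (wb.comul x)) = φ x) (y : H) :
    leftMulExtend (rTensor H g ∘ₗ wb.comul) (rTensor H f (wb.comul y))
      = rTensor H φ (wb.comul y) := by
  have key : ∀ t : H ⊗[k] H, leftMulExtend (rTensor H g ∘ₗ wb.comul) (rTensor H f t)
      = rTensor H (LinearMap.mul' k H ∘ₗ TensorProduct.map f g)
        ((TensorProduct.assoc k H H H).symm (lTensor H wb.comul t)) := by
    intro t
    induction t with
    | zero => simp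
    | add s t hs ht => simp only [map_add, hs, ht]
    | tmul a b =>
      rw [lTensor_tmul, rTensor_mul'_map_assoc_symm]
      rfl
  have hφ : (LinearMap.mul' k H ∘ₗ TensorProduct.map f g) ∘ₗ wb.comul = φ := LinearMap.ext h
  rw [key, ← wb.coassoc, LinearEquiv.symm_apply_apply, ← hφ, rTensor_comp_apply _ _ wb.comul]

/-- The regular coaction of a weak bialgebra on itself by comultiplication. -/
def regularComodAlg : ComodAlg wb H where
  ρ := wb.comul
  coassoc := wb.coassoc
  counital := wb.lTensor_counit_comul
  mul := wb.comul_mul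
  piL := wb.lTensor_projL_comul
  pibarR := wb.lTensor_projBarR_comul

theorem coinv_regularComodAlg : wb.regularComodAlg.coinv = Set.range wb.projL := by
  ext b
  constructor
  · intro hb
    have hb' : wb.comul b = wb.comul 1 * (b ⊗ₜ[k] (1 : H)) := hb
    exact ⟨b, by rw [projL_apply, ← hb', εid_comul]⟩
  · rintro ⟨x, rfl⟩
    exact wb.comul_projL x

/-- The Galois map of the regular coaction. -/
def galoisMap : wb.regularComodAlg.QA →ₗ[k] H ⊗[k] H :=
  wb.regularComodAlg.rel.liftQ (leftMulExtend wb.comul) <| by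
    rw [ComodAlg.rel, Submodule.span_le]
    rintro _ ⟨a, a', b, hb, rfl⟩
    rw [coinv_regularComodAlg] at hb
    obtain ⟨x, rfl⟩ := hb
    simp only [SetLike.mem_coe, LinearMap.mem_ker, map_sub, leftMulExtend_tmul, comul_projL_mul]
    rw [← mul_assoc, Algebra.TensorProduct.tmul_mul_tmul, one_mul, sub_self]

@[simp]
theorem galoisMap_mkA (t : H ⊗[k] H) :
    wb.galoisMap (wb.regularComodAlg.mkA t) = leftMulExtend wb.comul t := rfl

theorem leftMulExtend_comul_mul_comul_one (t : H ⊗[k] H) :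
    leftMulExtend wb.comul t * wb.comul 1 = leftMulExtend wb.comul t := by
  induction t with
  | zero => simp
  | add s t hs ht => rw [map_add, add_mul, hs, ht]
  | tmul a b => rw [leftMulExtend_tmul, mul_assoc, comul_mul_comul_one]

theorem mkA_mul_rTensor_projL (x : H) (t : H ⊗[k] H) :
    wb.regularComodAlg.mkA ((x ⊗ₜ[k] (1 : H)) * rTensor H wb.projL t)
      = wb.regularComodAlg.mkA
        (x ⊗ₜ[k] LinearMap.mul' k H (rTensor H wb.projL t)) := by
  induction t with
  | zero => simp
  | add s t hs ht => simp only [map_add, hs, ht, mul_add, TensorProduct.tmul_add]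
  | tmul a b =>
    rw [rTensor_tmul, mul'_apply, Algebra.TensorProduct.tmul_mul_tmul, one_mul]
    refine (Submodule.Quotient.eq _).2 (Submodule.subset_span ⟨x, b, wb.projL a, ?_, rfl⟩)
    rw [coinv_regularComodAlg]
    exact ⟨a, rfl⟩

variable {wb} {S : H →ₗ[k] H}

theorem IsAntipode.leftMulExtend_comul_leftMulExtend (hS : wb.IsAntipode S) (t : H ⊗[k] H) :
    leftMulExtend wb.comul (leftMulExtend (rTensor H S ∘ₗ wb.comul) t) = t * wb.comul 1 := by
  induction t with
  | zero => simp
  | add s t hs ht => rw [map_add, map_add, add_mul, hs, ht]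
  | tmul a b =>
    have h := wb.rTensor_mul'_comul S LinearMap.id wb.projR hS.antipode_left b
    rw [rTensor_id, LinearMap.id_comp] at h
    rw [leftMulExtend_tmul, leftMulExtend_mul, LinearMap.comp_apply, h, rTensor_projR_comul,
      ← mul_assoc, Algebra.TensorProduct.tmul_mul_tmul, one_mul, mul_one]

theorem IsAntipode.mkA_leftMulExtend_leftMulExtend_comul (hS : wb.IsAntipode S)
    (t : H ⊗[k] H) :
    wb.regularComodAlg.mkA
        (leftMulExtend (rTensor H S ∘ₗ wb.comul) (leftMulExtend wb.comul t))
      = wb.regularComodAlg.mkA t := by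
  induction t with
  | zero => simp
  | add s t hs ht => simp only [map_add, hs, ht]
  | tmul a b =>
    have h := wb.rTensor_mul'_comul LinearMap.id S wb.projL hS.antipode_right b
    rw [rTensor_id, LinearMap.id_apply] at h
    rw [leftMulExtend_tmul, leftMulExtend_mul, h, mkA_mul_rTensor_projL,
      mul'_rTensor_projL_comul]

theorem IsAntipode.galoisMap_injective (hS : wb.IsAntipode S) :
    Function.Injective wb.galoisMap := by
  refine Function.LeftInverse.injective
    (g := fun w => wb.regularComodAlg.mkA (leftMulExtend (rTensor H S ∘ₗ wb.comul) w)) ?_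
  intro q
  obtain ⟨t, rfl⟩ := wb.regularComodAlg.rel.mkQ_surjective q
  exact hS.mkA_leftMulExtend_leftMulExtend_comul t

theorem IsAntipode.range_galoisMap (hS : wb.IsAntipode S) :
    Set.range wb.galoisMap = Set.range (fun w : H ⊗[k] H => w * wb.comul 1) := by
  ext z
  constructor
  · rintro ⟨q, rfl⟩
    obtain ⟨t, rfl⟩ := wb.regularComodAlg.rel.mkQ_surjective q
    exact ⟨leftMulExtend wb.comul t, wb.leftMulExtend_comul_mul_comul_one t⟩
  · rintro ⟨w, rfl⟩
    exact ⟨wb.regularComodAlg.mkA (leftMulExtend (rTensor H S ∘ₗ wb.comul) w),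
      hS.leftMulExtend_comul_leftMulExtend w⟩

end WeakBialgebra

end Helpers

/-- for a weak Hopf algebra `H`, the comultiplication `ρ = Δ` makes `H` a right
`H`-comodule algebra whose coinvariants are `H^L = Im Π^L`, and the Galois map
`β : H ⊗_{H^L} H → (H ⊗ H)Δ(1)`, `x ⊗ y ↦ x y₍₁₎ ⊗ y₍₂₎`, is bijective; thus `H` is a weak
`H`-Galois extension of `H^L`. -/
theorem statement12 {k : Type*} [Field k] {H : Type*} [Ring H] [Algebra k H]
    [FiniteDimensional k H] (wb : WeakBialgebra k H) (S : H →ₗ[k] H) (hS : wb.IsAntipode S) :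
    ∃ ca : ComodAlg wb H,
      -- the coaction is the comultiplication
      ca.ρ = wb.comul ∧
      -- the coinvariant subalgebra is `H^L = Im Π^L`
      ca.coinv = Set.range ⇑wb.projL ∧
      -- the Galois map is bijective onto `(H ⊗ H)Δ(1)`
      ∃ β : ca.QA →ₗ[k] H ⊗[k] H,
        (∀ x y : H, β (ca.mkA (x ⊗ₜ[k] y)) = (x ⊗ₜ[k] (1 : H)) * wb.comul y) ∧
        Function.Injective β ∧
        Set.range ⇑β = Set.range (fun w : H ⊗[k] H => w * wb.comul 1) := by
  exact ⟨wb.regularComodAlg, rfl, wb.coinv_regularComodAlg, wb.galoisMap, fun _ _ => rfl,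
    hS.galoisMap_injective, hS.range_galoisMap⟩
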